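/- For ν = −1/2, the function x ↦ G_{ν,1}(x)/G_{ν,2}(x) = (3·ln(1 + x/3) − 2·ln(1 + x/2)) / (3·ln(1 + x/3) − ln(1 + x)) is strictly increasing on (0, ∞), and its limit as x → ∞ equals 1/2. -/

import Mathlib

open Set Filter Topology

theorem hasDerivAt_log_one_add_div {a x : ℝ} (ha : 0 < a) (hx : 0 ≤ x) :
    HasDerivAt (fun y : ℝ => Real.log (1 + y / a)) (1 / (a + x)) x := by
  have hpos : 0 < 1 + x / a := by positivity
  refine ((((hasDerivAt_id' x).div_const a).const_add 1).log hpos.ne').congr_deriv ?_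
  field_simp

theorem tendsto_log_one_add_div_div_log {a : ℝ} (ha : 0 < a) :
    Tendsto (fun x : ℝ => Real.log (1 + x / a) / Real.log x) atTop (𝓝 1) := by
  have hshift : Tendsto (fun x : ℝ => Real.log (x⁻¹ + 1 / a)) atTop (𝓝 (Real.log (0 + 1 / a))) :=
    (tendsto_inv_atTop_zero.add_const (1 / a)).log (by positivity)
  have hlim := (hshift.div_atTop Real.tendsto_log_atTop).const_add 1
  rw [add_zero] at hlim
  refine hlim.congr' ?_
  filter_upwards [eventually_gt_atTop 1] with x hx
  have hlog : Real.log x ≠ 0 := (Real.log_pos hx).ne'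
  have hx0 : 0 < x := by linarith
  have hmul : 1 + x / a = x * (x⁻¹ + 1 / a) := by field_simp
  rw [hmul, Real.log_mul hx0.ne' (by positivity), add_div, div_self hlog]

/-- A function vanishing at `0` with positive derivative on `(0, ∞)` is positive there. -/
theorem pos_of_hasDerivAt_pos {f f' : ℝ → ℝ} (hf : ∀ x, 0 ≤ x → HasDerivAt f (f' x) x)
    (hf' : ∀ x, 0 < x → 0 < f' x) (h0 : f 0 = 0) {x : ℝ} (hx : 0 < x) : 0 < f x := by
  have hmono : StrictMonoOn f (Ici 0) := by
    refine strictMonoOn_of_deriv_pos (convex_Ici 0)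
      (fun y hy => (hf y hy).continuousAt.continuousWithinAt) fun y hy => ?_
    rw [interior_Ici, mem_Ioi] at hy
    rw [(hf y hy.le).deriv]
    exact hf' y hy
  simpa [h0] using hmono self_mem_Ici hx.le hx

/-- Monotone form of l'Hôpital's rule on `(0, ∞)`: if `f` and `g` vanish at `0`, `g' > 0` and
`f' = r * g'` with `r' > 0`, then `f / g` is strictly increasing. -/
theorem strictMonoOn_div_of_hasDerivAt {f g g' r r' : ℝ → ℝ}
    (hf : ∀ x, 0 ≤ x → HasDerivAt f (r x * g' x) x)
    (hg : ∀ x, 0 ≤ x → HasDerivAt g (g' x) x)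
    (hr : ∀ x, 0 ≤ x → HasDerivAt r (r' x) x)
    (hg' : ∀ x, 0 < x → 0 < g' x) (hr' : ∀ x, 0 < x → 0 < r' x)
    (hf0 : f 0 = 0) (hg0 : g 0 = 0) :
    StrictMonoOn (fun x => f x / g x) (Ioi 0) := by
  have hgpos : ∀ x, 0 < x → 0 < g x := fun x hx => pos_of_hasDerivAt_pos hg hg' hg0 hx
  have hpos : ∀ x, 0 < x → 0 < r x * g x - f x := fun x hx =>
    pos_of_hasDerivAt_pos (f := fun y => r y * g y - f y) (f' := fun y => r' y * g y)
      (fun y hy => (((hr y hy).mul (hg y hy)).sub (hf y hy)).congr_deriv (by ring))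
      (fun y hy => mul_pos (hr' y hy) (hgpos y hy)) (by simp [hf0, hg0]) hx
  have hderiv : ∀ x, 0 < x → HasDerivAt (fun x => f x / g x)
      ((r x * g' x * g x - f x * g' x) / g x ^ 2) x := fun x hx =>
    (hf x hx.le).div (hg x hx.le) (hgpos x hx).ne'
  refine strictMonoOn_of_deriv_pos (convex_Ioi 0)
    (fun x hx => (hderiv x hx).continuousAt.continuousWithinAt) fun x hx => ?_
  rw [interior_Ioi, mem_Ioi] at hx
  rw [(hderiv x hx).deriv]
  refine div_pos ?_ (pow_pos (hgpos x hx) 2)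
  have := mul_pos (hg' x hx) (hpos x hx)
  linarith

theorem stmt_17 :
    StrictMonoOn (fun x : ℝ =>
        (3 * Real.log (1 + x/3) - 2 * Real.log (1 + x/2))
          / (3 * Real.log (1 + x/3) - Real.log (1 + x))) (Set.Ioi (0:ℝ))
    ∧ Filter.Tendsto (fun x : ℝ =>
        (3 * Real.log (1 + x/3) - 2 * Real.log (1 + x/2))
          / (3 * Real.log (1 + x/3) - Real.log (1 + x))) Filter.atTop (nhds (1/2)) := by
  constructor
  · refine strictMonoOn_div_of_hasDerivAt
      (f := fun x : ℝ => 3 * Real.log (1 + x/3) - 2 * Real.log (1 + x/2))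
      (g := fun x : ℝ => 3 * Real.log (1 + x/3) - Real.log (1 + x))
      (g' := fun x => 2 * x / ((3 + x) * (1 + x)))
      (r := fun x => (1 + x) / (2 * (2 + x))) (r' := fun x => 1 / (2 * (2 + x) ^ 2))
      (fun x hx => ?_) (fun x hx => ?_) (fun x hx => ?_) (fun x hx => by positivity)
      (fun x hx => by positivity) (by simp) (by simp)
    · refine (((hasDerivAt_log_one_add_div three_pos hx).const_mul 3).sub
        ((hasDerivAt_log_one_add_div two_pos hx).const_mul 2)).congr_deriv ?_
      field_simp
      ring
    · have h1 := hasDerivAt_log_one_add_div one_pos hx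
      simp only [div_one] at h1
      refine (((hasDerivAt_log_one_add_div three_pos hx).const_mul 3).sub h1).congr_deriv ?_
      field_simp
      ring
    · refine (((hasDerivAt_id' x).const_add 1).div
        (((hasDerivAt_id' x).const_add 2).const_mul 2) (by positivity)).congr_deriv ?_
      field_simp
      ring
  · have h1 := tendsto_log_one_add_div_div_log one_pos
    have h2 := tendsto_log_one_add_div_div_log two_pos
    have h3 := tendsto_log_one_add_div_div_log three_pos
    simp only [div_one] at h1
    have hlim := ((h3.const_mul 3).sub (h2.const_mul 2)).div ((h3.const_mul 3).sub h1)
      (by norm_num)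
    rw [show ((3 : ℝ) * 1 - 2 * 1) / (3 * 1 - 1) = 1 / 2 by norm_num] at hlim
    refine hlim.congr' ?_
    filter_upwards [eventually_gt_atTop 1] with x hx
    have hlog : Real.log x ≠ 0 := (Real.log_pos hx).ne'
    simp only [Pi.div_apply, ← mul_div_assoc, ← sub_div]
    exact div_div_div_cancel_right₀ hlog _ _
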